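/- The satisfiability problem over expanding 2-frames with horizontal frame a finite linear order and all vertical frames difference frames is decidable: the set of bimodal formulas satisfied in some model based on an expanding 2-frame whose horizontal frame is a finite linear order and whose vertical frames are difference frames is computable. -/

import Mathlib

namespace HK

/-! ## Bimodal formulas -/

/-- Bimodal formulas: `φ ::= P | ¬φ | φ∧ψ | ◇₀φ | ◇₁φ`. -/
inductive BForm : Type
  | var : ℕ → BForm
  | neg : BForm → BForm
  | and : BForm → BForm → BForm
  | dia0 : BForm → BForm
  | dia1 : BForm → BForm

namespace BForm

def imp (φ ψ : BForm) : BForm := neg (and φ (neg ψ))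
def bot : BForm := and (var 0) (neg (var 0))
def top : BForm := neg bot
def box0 (φ : BForm) : BForm := neg (dia0 (neg φ))
def box1 (φ : BForm) : BForm := neg (dia1 (neg φ))
/-- `□₀⁺φ := φ ∧ □₀φ` -/
def boxP0 (φ : BForm) : BForm := and φ (box0 φ)
/-- `□₁⁺φ := φ ∧ □₁φ` -/
def boxP1 (φ : BForm) : BForm := and φ (box1 φ)

/-- Modal nesting depth. -/
def depth : BForm → ℕ
  | var _ => 0
  | neg φ => depth φ
  | and φ ψ => max (depth φ) (depth ψ)
  | dia0 φ => depth φ + 1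
  | dia1 φ => depth φ + 1

/-- The propositional variable `k` occurs in the formula. -/
def Occurs (k : ℕ) : BForm → Prop
  | var n => k = n
  | neg φ => Occurs k φ
  | and φ ψ => Occurs k φ ∨ Occurs k ψ
  | dia0 φ => Occurs k φ
  | dia1 φ => Occurs k φ

/-- The formula uses only the modal operator `◇₀`. -/
def OnlyDia0 : BForm → Prop
  | var _ => True
  | neg φ => OnlyDia0 φ
  | and φ ψ => OnlyDia0 φ ∧ OnlyDia0 ψ
  | dia0 φ => OnlyDia0 φ
  | dia1 _ => False

/-- The formula uses only the modal operator `◇₁`. -/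
def OnlyDia1 : BForm → Prop
  | var _ => True
  | neg φ => OnlyDia1 φ
  | and φ ψ => OnlyDia1 φ ∧ OnlyDia1 ψ
  | dia0 _ => False
  | dia1 φ => OnlyDia1 φ

/-- Relativisation `φ^D` of each diamond to the variable `d`:
each subformula `◇ᵢψ` is replaced by `◇ᵢ(D ∧ ψ^D)`. -/
def relativize (d : ℕ) : BForm → BForm
  | var n => var n
  | neg φ => neg (relativize d φ)
  | and φ ψ => and (relativize d φ) (relativize d ψ)
  | dia0 φ => dia0 (and (var d) (relativize d φ))
  | dia1 φ => dia1 (and (var d) (relativize d φ))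

/-- `□₀^k φ` -/
def iterBox0 : ℕ → BForm → BForm
  | 0, φ => φ
  | n+1, φ => box0 (iterBox0 n φ)

/-- `□₁^k φ` -/
def iterBox1 : ℕ → BForm → BForm
  | 0, φ => φ
  | n+1, φ => box1 (iterBox1 n φ)

/-- `□₀^{≤n} φ := ⋀_{k ≤ n} □₀^k φ` -/
def boxLe0 : ℕ → BForm → BForm
  | 0, φ => φ
  | n+1, φ => and (boxLe0 n φ) (iterBox0 (n+1) φ)

/-- `□₁^{≤n} φ := ⋀_{k ≤ n} □₁^k φ` -/
def boxLe1 : ℕ → BForm → BForm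
  | 0, φ => φ
  | n+1, φ => and (boxLe1 n φ) (iterBox1 (n+1) φ)

/-- Uniform substitution. -/
def subst (s : ℕ → BForm) : BForm → BForm
  | var n => s n
  | neg φ => neg (subst s φ)
  | and φ ψ => and (subst s φ) (subst s ψ)
  | dia0 φ => dia0 (subst s φ)
  | dia1 φ => dia1 (subst s φ)

end BForm

/-- Kripke truth over a 2-frame `⟨W, R0, R1⟩` with valuation `val`. -/
def BSat {W : Type} (R0 R1 : W → W → Prop) (val : ℕ → W → Prop) : W → BForm → Prop
  | w, .var n => val n w
  | w, .neg φ => ¬ BSat R0 R1 val w φ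
  | w, .and φ ψ => BSat R0 R1 val w φ ∧ BSat R0 R1 val w ψ
  | w, .dia0 φ => ∃ v, R0 w v ∧ BSat R0 R1 val v φ
  | w, .dia1 φ => ∃ v, R1 w v ∧ BSat R0 R1 val v φ

/-! ## Frames -/

/-- A (unimodal) frame: a nonempty set with a binary relation. -/
structure Frame : Type 1 where
  W : Type
  R : W → W → Prop
  ne : Nonempty W

/-- A 2-frame: a nonempty set with two binary relations. -/
structure Frame2 : Type 1 where
  W : Type
  R0 : W → W → Prop
  R1 : W → W → Prop
  ne : Nonempty W

/-- Validity of a bimodal formula in a 2-frame. -/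
def Frame2.Valid (F : Frame2) (φ : BForm) : Prop :=
  ∀ (val : ℕ → F.W → Prop) (w : F.W), BSat F.R0 F.R1 val w φ

/-- Satisfaction of a bimodal formula in some model based on the 2-frame. -/
def Frame2.Sat (F : Frame2) (φ : BForm) : Prop :=
  ∃ (val : ℕ → F.W → Prop) (w : F.W), BSat F.R0 F.R1 val w φ

/-- Horizontal relation of a product frame. -/
def prodR0 {A B : Type} (R : A → A → Prop) : A × B → A × B → Prop :=
  fun p q => R p.1 q.1 ∧ p.2 = q.2

/-- Vertical relation of a product frame. -/
def prodR1 {A B : Type} (S : B → B → Prop) : A × B → A × B → Prop :=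
  fun p q => p.1 = q.1 ∧ S p.2 q.2

/-- `φ` is satisfied in some model based on the product frame `⟨A,R⟩ × ⟨B,S⟩`. -/
def ProdSat {A B : Type} (R : A → A → Prop) (S : B → B → Prop) (φ : BForm) : Prop :=
  ∃ (val : ℕ → A × B → Prop) (w : A × B), BSat (prodR0 R) (prodR1 S) val w φ

/-- `φ` is valid in the product frame `⟨A,R⟩ × ⟨B,S⟩`. -/
def ProdValid {A B : Type} (R : A → A → Prop) (S : B → B → Prop) (φ : BForm) : Prop :=
  ∀ (val : ℕ → A × B → Prop) (w : A × B), BSat (prodR0 R) (prodR1 S) val w φ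

/-- The product 2-frame of two frames. -/
def prodFrame2 (A B : Type) [Nonempty A] [Nonempty B]
    (R : A → A → Prop) (S : B → B → Prop) : Frame2 :=
  ⟨A × B, prodR0 R, prodR1 S, inferInstance⟩

/-- Linear order: irreflexive, transitive and trichotomous. -/
def IsLin {T : Type} (R : T → T → Prop) : Prop :=
  (∀ x, ¬ R x x) ∧ (∀ x y z, R x y → R y z → R x z) ∧ (∀ x y, R x y ∨ x = y ∨ R y x)

/-- Weak order: transitive and weakly connected. -/
def WeakOrd {T : Type} (R : T → T → Prop) : Prop :=
  (∀ x y z, R x y → R y z → R x z) ∧ (∀ x y z, R x y → R x z → y = z ∨ R y z ∨ R z y)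

/-- Modal discreteness. -/
def ModallyDiscrete {T : Type} (R : T → T → Prop) : Prop :=
  ¬ ∃ (x : ℕ → T) (xω : T), (∀ i, R (x i) (x (i+1))) ∧ (∀ i, x i ≠ x (i+1)) ∧
      (∀ i, R (x i) xω) ∧ (∀ i, ¬ R xω (x i))

/-- No infinite ascending chains of distinct points. -/
def Noetherian {T : Type} (R : T → T → Prop) : Prop :=
  ¬ ∃ x : ℕ → T, (∀ i, R (x i) (x (i+1))) ∧ (∀ i, x i ≠ x (i+1))

/-- The frame is (isomorphic to) `⟨ω,<⟩`. -/
def IsOmegaFrame (F : Frame) : Prop :=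
  ∃ e : F.W ≃ ℕ, ∀ a b, F.R a b ↔ e a < e b

/-- The frame is a finite linear order. -/
def IsFinLinFrame (F : Frame) : Prop := Finite F.W ∧ IsLin F.R

/-- `F` contains an `⟨ω+1,>⟩`-type chain: distinct points `x₀,…,x_n,…,x_ω` with
`x_n R x_m` iff `n > m` (for `n ≠ m`). -/
def HasOmegaPlusOneChain (F : Frame) : Prop :=
  ∃ (x : ℕ → F.W) (xω : F.W), Function.Injective x ∧ (∀ n, x n ≠ xω) ∧
    (∀ n m, n ≠ m → (F.R (x n) (x m) ↔ m < n)) ∧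
    (∀ n, F.R xω (x n)) ∧ (∀ n, ¬ F.R (x n) xω)

/-! ## Two-dimensional (expanding/decreasing) 2-frames `H_{F,Ḡ}` -/

/-- A 2-frame `H_{F,Ḡ}` built from a horizontal frame `⟨H,R⟩` and, for each `x : H`,
a vertical frame `G_x = ⟨D x, S x⟩` carved out of a common ambient type `V`. -/
structure TwoFrame : Type 1 where
  H : Type
  R : H → H → Prop
  Hne : Nonempty H
  V : Type
  D : H → Set V
  S : H → V → V → Prop
  Dne : ∀ x, (D x).Nonempty

namespace TwoFrame

/-- The horizontal frame. -/
def horiz (T : TwoFrame) : Frame := ⟨T.H, T.R, T.Hne⟩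

/-- The vertical frame `G_x` at `x`. -/
def fiber (T : TwoFrame) (x : T.H) : Frame :=
  ⟨{a : T.V // a ∈ T.D x}, fun a b => T.S x a.1 b.1,
    Exists.elim (T.Dne x) (fun a ha => ⟨⟨a, ha⟩⟩)⟩

/-- The worlds `{⟨u,v⟩ : u ∈ H, v ∈ D u}`. -/
def Worlds (T : TwoFrame) : Type := {p : T.H × T.V // p.2 ∈ T.D p.1}

/-- Horizontal relation of `H_{F,Ḡ}`. -/
def Rh (T : TwoFrame) : T.Worlds → T.Worlds → Prop :=
  fun p q => T.R p.1.1 q.1.1 ∧ p.1.2 = q.1.2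

/-- Vertical relation of `H_{F,Ḡ}`. -/
def Rv (T : TwoFrame) : T.Worlds → T.Worlds → Prop :=
  fun p q => p.1.1 = q.1.1 ∧ T.S p.1.1 p.1.2 q.1.2

/-- `φ` is satisfied in some model based on `H_{F,Ḡ}`. -/
def Sat (T : TwoFrame) (φ : BForm) : Prop :=
  ∃ (val : ℕ → T.Worlds → Prop) (w : T.Worlds), BSat T.Rh T.Rv val w φ

/-- Decreasing 2-frame: `G_y` is a subframe of `G_x` whenever `x R y`. -/
def Decreasing (T : TwoFrame) : Prop :=
  ∀ x y, T.R x y → T.D y ⊆ T.D x ∧ ∀ a ∈ T.D y, ∀ b ∈ T.D y, (T.S y a b ↔ T.S x a b)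

/-- Expanding 2-frame: `G_x` is a subframe of `G_y` whenever `x R y`. -/
def Expanding (T : TwoFrame) : Prop :=
  ∀ x y, T.R x y → T.D x ⊆ T.D y ∧ ∀ a ∈ T.D x, ∀ b ∈ T.D x, (T.S x a b ↔ T.S y a b)

/-- All vertical frames are difference frames. -/
def DiffFibers (T : TwoFrame) : Prop :=
  ∀ x, ∀ a ∈ T.D x, ∀ b ∈ T.D x, (T.S x a b ↔ a ≠ b)

end TwoFrame

/-- `φ` is satisfied in some model based on a product of a member of `C`
with a difference frame. -/
def ProdDiffSat (C : Frame → Prop) (φ : BForm) : Prop :=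
  ∃ F : Frame, C F ∧ ∃ D : Type, Nonempty D ∧ ProdSat F.R (fun a b : D => a ≠ b) φ

/-- `φ` is satisfied in some model based on a decreasing 2-frame with horizontal
frame in `C` and all vertical frames difference frames. -/
def DecDiffSat (C : Frame → Prop) (φ : BForm) : Prop :=
  ∃ T : TwoFrame, C T.horiz ∧ T.Decreasing ∧ T.DiffFibers ∧ T.Sat φ

/-- `φ` is satisfied in some model based on an expanding 2-frame with horizontal
frame in `C` and all vertical frames difference frames. -/
def ExpDiffSat (C : Frame → Prop) (φ : BForm) : Prop :=
  ∃ T : TwoFrame, C T.horiz ∧ T.Expanding ∧ T.DiffFibers ∧ T.Sat φ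

/-- `φ` is satisfied in some model based on a product of a member of `C0` with a
member of `C1`. -/
def ProdClassSat (C0 C1 : Frame → Prop) (φ : BForm) : Prop :=
  ∃ F0, C0 F0 ∧ ∃ F1, C1 F1 ∧ ProdSat F0.R F1.R φ

/-- `φ` is satisfied in some model based on a decreasing 2-frame with horizontal
frame in `C0` and all vertical frames in `C1`. -/
def DecClassSat (C0 C1 : Frame → Prop) (φ : BForm) : Prop :=
  ∃ T : TwoFrame, C0 T.horiz ∧ (∀ x, C1 (T.fiber x)) ∧ T.Decreasing ∧ T.Sat φ

/-- `φ` is satisfied in some model based on an expanding 2-frame with horizontal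
frame in `C0` and all vertical frames in `C1`. -/
def ExpClassSat (C0 C1 : Frame → Prop) (φ : BForm) : Prop :=
  ∃ T : TwoFrame, C0 T.horiz ∧ (∀ x, C1 (T.fiber x)) ∧ T.Expanding ∧ T.Sat φ

/-- Satisfiability over products of `⟨ω,<⟩` with difference frames. -/
def OmegaDiffSat (φ : BForm) : Prop :=
  ∃ D : Type, Nonempty D ∧ ProdSat (fun m n : ℕ => m < n) (fun a b : D => a ≠ b) φ

/-- Satisfiability over products of finite linear orders with difference frames. -/
def FinLinDiffSat (φ : BForm) : Prop :=
  ∃ (T : Type) (R : T → T → Prop), Finite T ∧ IsLin R ∧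
    ∃ D : Type, Nonempty D ∧ ProdSat R (fun a b : D => a ≠ b) φ

/-! ## Bimodal logics -/

/-- Propositional tautology (diamond formulas treated as atoms). -/
def IsTaut (φ : BForm) : Prop :=
  ∀ v : BForm → Prop, (∀ ψ, v (BForm.neg ψ) ↔ ¬ v ψ) →
    (∀ ψ χ, v (BForm.and ψ χ) ↔ v ψ ∧ v χ) → v φ

/-- Normal bimodal logic. -/
structure IsLogic (L : Set BForm) : Prop where
  taut : ∀ φ, IsTaut φ → φ ∈ L
  K0 : BForm.imp (BForm.box0 (BForm.imp (BForm.var 0) (BForm.var 1)))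
        (BForm.imp (BForm.box0 (BForm.var 0)) (BForm.box0 (BForm.var 1))) ∈ L
  K1 : BForm.imp (BForm.box1 (BForm.imp (BForm.var 0) (BForm.var 1)))
        (BForm.imp (BForm.box1 (BForm.var 0)) (BForm.box1 (BForm.var 1))) ∈ L
  mp : ∀ φ ψ, BForm.imp φ ψ ∈ L → φ ∈ L → ψ ∈ L
  subst : ∀ φ s, φ ∈ L → BForm.subst s φ ∈ L
  nec0 : ∀ φ, φ ∈ L → BForm.box0 φ ∈ L
  nec1 : ∀ φ, φ ∈ L → BForm.box1 φ ∈ L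

/-- Validity of a (◇₀-)formula in a unimodal frame `⟨W,R⟩`. -/
def UValid0 {W : Type} (R : W → W → Prop) (φ : BForm) : Prop :=
  ∀ (val : ℕ → W → Prop) (w : W), BSat R (fun _ _ => False) val w φ

/-- Validity of a (◇₁-)formula in a unimodal frame `⟨W,S⟩`. -/
def UValid1 {W : Type} (S : W → W → Prop) (φ : BForm) : Prop :=
  ∀ (val : ℕ → W → Prop) (w : W), BSat (fun _ _ => False) S val w φ

/-- `K4.3`: the unimodal logic (in `◇₀`) of all linear orders. -/
def K43 : Set BForm :=
  {φ | φ.OnlyDia0 ∧ ∀ (T : Type) (R : T → T → Prop), Nonempty T → IsLin R → UValid0 R φ}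

/-- `Diff`: the unimodal logic (in `◇₁`) of all difference frames. -/
def DiffLogic : Set BForm :=
  {φ | φ.OnlyDia1 ∧ ∀ (D : Type), Nonempty D → UValid1 (fun a b : D => a ≠ b) φ}

/-- `Log⟨ω,<⟩`: the unimodal logic (in `◇₀`) of the frame `⟨ω,<⟩`. -/
def LogOmega : Set BForm :=
  {φ | φ.OnlyDia0 ∧ UValid0 (fun m n : ℕ => m < n) φ}

/-- `GL.3`: the unimodal logic (in `◇₀`) of all Noetherian irreflexive linear orders. -/
def GL3 : Set BForm :=
  {φ | φ.OnlyDia0 ∧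
    ∀ (T : Type) (R : T → T → Prop), Nonempty T → IsLin R → Noetherian R → UValid0 R φ}

/-- `DisK4.3`: the unimodal logic (in `◇₀`) of all modally discrete weak orders. -/
def DisK43 : Set BForm :=
  {φ | φ.OnlyDia0 ∧
    ∀ (T : Type) (R : T → T → Prop), Nonempty T → WeakOrd R → ModallyDiscrete R → UValid0 R φ}

def commAx1 : BForm :=
  BForm.imp (BForm.box1 (BForm.box0 (BForm.var 0))) (BForm.box0 (BForm.box1 (BForm.var 0)))
def commAx2 : BForm :=
  BForm.imp (BForm.box0 (BForm.box1 (BForm.var 0))) (BForm.box1 (BForm.box0 (BForm.var 0)))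
def commAx3 : BForm :=
  BForm.imp (BForm.dia0 (BForm.box1 (BForm.var 0))) (BForm.box1 (BForm.dia0 (BForm.var 0)))

/-- The commutator `[L0,L1]`: the smallest bimodal logic containing `L0`, `L1` (and
hence their fusion) together with the commutativity/confluence axioms. -/
def Commutator (L0 L1 : Set BForm) : Set BForm :=
  ⋂₀ {L : Set BForm | IsLogic L ∧ L0 ⊆ L ∧ L1 ⊆ L ∧
      commAx1 ∈ L ∧ commAx2 ∈ L ∧ commAx3 ∈ L}

/-- The product logic `L0 × L1`: the logic of all products of a frame for `L0`
with a frame for `L1`. -/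
def ProdLogic (L0 L1 : Set BForm) : Set BForm :=
  {φ | ∀ (A B : Type), Nonempty A → Nonempty B → ∀ (R : A → A → Prop) (S : B → B → Prop),
      (∀ ψ ∈ L0, UValid0 R ψ) → (∀ ψ ∈ L1, UValid1 S ψ) → ProdValid R S φ}

/-- The logic of a class of 2-frames. -/
def LogOf (C : Frame2 → Prop) : Set BForm := {φ | ∀ F, C F → F.Valid φ}

/-- Kripke completeness of a bimodal logic. -/
def KripkeComplete (L : Set BForm) : Prop := ∃ C : Frame2 → Prop, L = LogOf C

/-- `L`-satisfiability: `φ` is satisfied in some model `M` with `M ⊨ L`. -/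
def LSat (L : Set BForm) (φ : BForm) : Prop :=
  ∃ (W : Type) (_ : Nonempty W) (R0 R1 : W → W → Prop) (val : ℕ → W → Prop),
    (∀ ψ ∈ L, ∀ w, BSat R0 R1 val w ψ) ∧ ∃ w, BSat R0 R1 val w φ

/-! ## One-variable first-order temporal logic with counting (FOLTL≠) -/

/-- FOLTL≠-formulas: `φ ::= P(x) | ¬φ | φ∧ψ | ◇_F φ | ∃≠x φ`. -/
inductive TForm : Type
  | atom : ℕ → TForm
  | neg : TForm → TForm
  | and : TForm → TForm → TForm
  | diaF : TForm → TForm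
  | exNe : TForm → TForm

/-- Truth of an FOLTL≠-formula in a first-order temporal model based on the
timeline `⟨T,lt⟩` with domains `D` and interpretation `I`. -/
def TSat {T U : Type} (lt : T → T → Prop) (D : T → Set U) (I : ℕ → T → U → Prop) :
    T → U → TForm → Prop
  | t, a, .atom n => I n t a
  | t, a, .neg φ => ¬ TSat lt D I t a φ
  | t, a, .and φ ψ => TSat lt D I t a φ ∧ TSat lt D I t a ψ
  | t, a, .diaF φ => ∃ t', lt t t' ∧ a ∈ D t' ∧ TSat lt D I t' a φ
  | t, a, .exNe φ => ∃ b, b ∈ D t ∧ b ≠ a ∧ TSat lt D I t b φ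

/-- The standard translation `⋆` from FOLTL≠-formulas to bimodal formulas. -/
def TForm.star : TForm → BForm
  | .atom n => .var n
  | .neg φ => .neg (TForm.star φ)
  | .and φ ψ => .and (TForm.star φ) (TForm.star ψ)
  | .diaF φ => .dia0 (TForm.star φ)
  | .exNe φ => .dia1 (TForm.star φ)

/-- Satisfiability in constant domain models over the timeline `⟨T,lt⟩`. -/
def FOLTLConstSat {T : Type} (lt : T → T → Prop) (φ : TForm) : Prop :=
  ∃ (U : Type) (I : ℕ → T → U → Prop) (t : T) (a : U),
    TSat lt (fun _ => (Set.univ : Set U)) I t a φ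

/-- Satisfiability in decreasing domain models over the timeline `⟨T,lt⟩`. -/
def FOLTLDecSat {T : Type} (lt : T → T → Prop) (φ : TForm) : Prop :=
  ∃ (U : Type) (D : T → Set U), (∀ t, (D t).Nonempty) ∧
    (∀ t t', lt t t' → D t' ⊆ D t) ∧
    ∃ (I : ℕ → T → U → Prop) (t : T) (a : U), a ∈ D t ∧ TSat lt D I t a φ

/-- Satisfiability in expanding domain models over the timeline `⟨T,lt⟩`. -/
def FOLTLExpSat {T : Type} (lt : T → T → Prop) (φ : TForm) : Prop :=
  ∃ (U : Type) (D : T → Set U), (∀ t, (D t).Nonempty) ∧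
    (∀ t t', lt t t' → D t ⊆ D t') ∧
    ∃ (I : ℕ → T → U → Prop) (t : T) (a : U), a ∈ D t ∧ TSat lt D I t a φ

/-- Satisfiability in constant domain models over a class `C` of timelines. -/
def FOLTLConstSatC (C : Frame → Prop) (φ : TForm) : Prop :=
  ∃ F, C F ∧ FOLTLConstSat F.R φ

/-- Satisfiability in decreasing domain models over a class `C` of timelines. -/
def FOLTLDecSatC (C : Frame → Prop) (φ : TForm) : Prop :=
  ∃ F, C F ∧ FOLTLDecSat F.R φ

/-- Satisfiability in expanding domain models over a class `C` of timelines. -/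
def FOLTLExpSatC (C : Frame → Prop) (φ : TForm) : Prop :=
  ∃ F, C F ∧ FOLTLExpSat F.R φ

/-- The class of all linear orders. -/
def AllLin : Frame → Prop := fun F => IsLin F.R

/-- The class of all finite linear orders. -/
def AllFinLin : Frame → Prop := IsFinLinFrame

/-! ## Gödel numbering -/

/-- A fixed effective Gödel numbering of bimodal formulas. -/
def encodeB : BForm → ℕ
  | .var n => Nat.pair 0 n
  | .neg φ => Nat.pair 1 (encodeB φ)
  | .and φ ψ => Nat.pair 2 (Nat.pair (encodeB φ) (encodeB ψ))
  | .dia0 φ => Nat.pair 3 (encodeB φ)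
  | .dia1 φ => Nat.pair 4 (encodeB φ)

/-- A fixed effective Gödel numbering of FOLTL≠-formulas. -/
def encodeT : TForm → ℕ
  | .atom n => Nat.pair 0 n
  | .neg φ => Nat.pair 1 (encodeT φ)
  | .and φ ψ => Nat.pair 2 (Nat.pair (encodeT φ) (encodeT ψ))
  | .diaF φ => Nat.pair 3 (encodeT φ)
  | .exNe φ => Nat.pair 4 (encodeT φ)

/-- The set of codes of bimodal formulas with property `P`. -/
def BCodes (P : BForm → Prop) : ℕ → Prop := fun n => ∃ φ, encodeB φ = n ∧ P φ

/-- The set of codes of FOLTL≠-formulas with property `P`. -/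
def TCodes (P : TForm → Prop) : ℕ → Prop := fun n => ∃ φ, encodeT φ = n ∧ P φ

/-! ## The analytical hierarchy: Σ₁¹ -/

/-- `A ⊆ ℕ` is `Σ₁¹`: in normal form `n ∈ A ↔ ∃ f : ℕ → ℕ, ∀ m, R (n, f̄(m))`
for a computable predicate `R` of the number `n` and finite initial segments of `f`. -/
def Sigma11 (A : ℕ → Prop) : Prop :=
  ∃ R : ℕ × List ℕ → Prop, ComputablePred R ∧
    ∀ n, A n ↔ ∃ f : ℕ → ℕ, ∀ m, R (n, (List.range m).map f)

/-- `Σ₁¹`-hardness with respect to computable many-one reducibility. -/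
def Sigma11Hard (A : ℕ → Prop) : Prop := ∀ B : ℕ → Prop, Sigma11 B → ManyOneReducible B A

/-- `Σ₁¹`-completeness. -/
def Sigma11Complete (A : ℕ → Prop) : Prop := Sigma11 A ∧ Sigma11Hard A

/-! ## Counter (Minsky) machines -/

/-- Counter machine operations: `inl i` increments counter `i`, `inr (inl i)`
decrements counter `i`, `inr (inr i)` zero-tests counter `i`. -/
abbrev CMOp : Type := ℕ ⊕ ℕ ⊕ ℕ

def CMOp.counter : CMOp → ℕ
  | Sum.inl i => i
  | Sum.inr (Sum.inl i) => i
  | Sum.inr (Sum.inr i) => i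

/-- Description of a counter machine: number `N` of counters, number of states
(states are `0,…,states-1`), list of terminal states, and list of instructions
`(q, op, q')`. -/
abbrev CMDesc : Type := ℕ × ℕ × List ℕ × List (ℕ × CMOp × ℕ)

/-- Well-formedness of a counter machine description: `N > 1`, terminal states are
states, instructions are attached to non-terminal states and mention genuine
counters, and every non-terminal state has at least one instruction. -/
def CMWF (M : CMDesc) : Prop :=
  1 < M.1 ∧ (∀ q ∈ M.2.2.1, q < M.2.1) ∧
  (∀ t ∈ M.2.2.2, t.1 < M.2.1 ∧ t.1 ∉ M.2.2.1 ∧ t.2.2 < M.2.1 ∧ CMOp.counter t.2.1 < M.1) ∧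
  (∀ q, q < M.2.1 → q ∉ M.2.2.1 → ∃ t ∈ M.2.2.2, t.1 = q)

/-- A configuration: current state and contents of the counters. -/
abbrev CMConfig : Type := ℕ × (ℕ → ℕ)

/-- Reliable step of a counter machine. -/
def CMStep (M : CMDesc) (σ σ' : CMConfig) : Prop :=
  ∃ op q', (σ.1, op, q') ∈ M.2.2.2 ∧ σ'.1 = q' ∧
    match op with
    | Sum.inl i => σ'.2 i = σ.2 i + 1 ∧ ∀ j, j ≠ i → σ'.2 j = σ.2 j
    | Sum.inr (Sum.inl i) => 0 < σ.2 i ∧ σ'.2 i + 1 = σ.2 i ∧ ∀ j, j ≠ i → σ'.2 j = σ.2 j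
    | Sum.inr (Sum.inr i) => σ.2 i = 0 ∧ ∀ j, σ'.2 j = σ.2 j

/-- Lossy step of a counter machine. -/
def CMStepLossy (M : CMDesc) (σ σ' : CMConfig) : Prop :=
  ∃ c1 c2 : ℕ → ℕ, CMStep M (σ.1, c1) (σ'.1, c2) ∧ (∀ i, c1 i ≤ σ.2 i) ∧ (∀ i, σ'.2 i ≤ c2 i)

/-- The configuration `⟨q, 𝟎⟩` with all-0 counters. -/
def zeroConfig (q : ℕ) : CMConfig := (q, fun _ => 0)

/-- CM non-termination: the machine has an infinite run starting with `⟨q₀,𝟎⟩`. -/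
def CMNonTerm : CMDesc × ℕ → Prop := fun p =>
  CMWF p.1 ∧ ∃ ρ : ℕ → CMConfig, ρ 0 = zeroConfig p.2 ∧ ∀ n, CMStep p.1 (ρ n) (ρ (n+1))

/-- CM reachability: the machine has a run starting with `⟨q₀,𝟎⟩` reaching `q_r`. -/
def CMReach : CMDesc × ℕ × ℕ → Prop := fun p =>
  CMWF p.1 ∧ ∃ (B : ℕ) (ρ : ℕ → CMConfig), ρ 0 = zeroConfig p.2.1 ∧
    (∀ n, n < B → CMStep p.1 (ρ n) (ρ (n+1))) ∧ (ρ B).1 = p.2.2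

/-- CM recurrence: the machine has an infinite run starting with `⟨q₀,𝟎⟩`
visiting `q_r` infinitely often. -/
def CMRecur : CMDesc × ℕ × ℕ → Prop := fun p =>
  CMWF p.1 ∧ ∃ ρ : ℕ → CMConfig, ρ 0 = zeroConfig p.2.1 ∧
    (∀ n, CMStep p.1 (ρ n) (ρ (n+1))) ∧ ∀ n, ∃ m, n ≤ m ∧ (ρ m).1 = p.2.2

/-- LCM reachability: the machine has a lossy run starting with `⟨q₀,𝟎⟩`
reaching `q_r`. -/
def LCMReach : CMDesc × ℕ × ℕ → Prop := fun p =>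
  CMWF p.1 ∧ ∃ (B : ℕ) (ρ : ℕ → CMConfig), ρ 0 = zeroConfig p.2.1 ∧
    (∀ n, n < B → CMStepLossy p.1 (ρ n) (ρ (n+1))) ∧ (ρ B).1 = p.2.2

/-- LCM ω-reachability: for every `k`, the machine has a lossy run starting with
`⟨q₀,𝟎⟩` visiting `q_r` at least `k` times. -/
def LCMOmegaReach : CMDesc × ℕ × ℕ → Prop := fun p =>
  CMWF p.1 ∧ ∀ k : ℕ, ∃ (B : ℕ) (ρ : ℕ → CMConfig), ρ 0 = zeroConfig p.2.1 ∧
    (∀ n, n < B → CMStepLossy p.1 (ρ n) (ρ (n+1))) ∧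
    k ≤ ((Finset.range (B+1)).filter (fun n => (ρ n).1 = p.2.2)).card

/-! ## Particular formulas used in the statements -/

/-- `□₁⁺□₀⁺(◇₀⊤ → □₁◇₀⊤) ∧ φ` (Prop. 2.4 of the paper). -/
def diffDecForm (φ : BForm) : BForm :=
  BForm.and
    (BForm.boxP1 (BForm.boxP0
      (BForm.imp (BForm.dia0 BForm.top) (BForm.box1 (BForm.dia0 BForm.top))))) φ

/-- `D ∧ □₀^{≤n}□₁^{≤n}(◇₀D → D) ∧ φ^D`. -/
def decRelForm (d n : ℕ) (φ : BForm) : BForm :=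
  BForm.and (BForm.var d)
    (BForm.and
      (BForm.boxLe0 n (BForm.boxLe1 n
        (BForm.imp (BForm.dia0 (BForm.var d)) (BForm.var d))))
      (BForm.relativize d φ))

/-- `D ∧ □₀^{≤n}□₁^{≤n}(D → □₀D) ∧ φ^D`. -/
def expRelForm (d n : ℕ) (φ : BForm) : BForm :=
  BForm.and (BForm.var d)
    (BForm.and
      (BForm.boxLe0 n (BForm.boxLe1 n
        (BForm.imp (BForm.var d) (BForm.box0 (BForm.var d)))))
      (BForm.relativize d φ))

/-! ## Quasimodels -/

/-- A quasimodel of length `n` for the formula with code `e`. -/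
structure QM (e n : ℕ) {V : Type} (D : ℕ → V → Prop) (L : ℕ → V → ℕ → Prop) : Prop where
  pos : 0 < n
  root : ∃ a, D 0 a ∧ L 0 a e
  mono : ∀ s t a, s < t → t < n → D s a → D t a
  cneg : ∀ t < n, ∀ a, D t a → ∀ r, Nat.pair 1 r ≤ e → (L t a (Nat.pair 1 r) ↔ ¬ L t a r)
  cand : ∀ t < n, ∀ a, D t a → ∀ r s, Nat.pair 2 (Nat.pair r s) ≤ e →
    (L t a (Nat.pair 2 (Nat.pair r s)) ↔ L t a r ∧ L t a s)
  cd0 : ∀ t < n, ∀ a, D t a → ∀ r, Nat.pair 3 r ≤ e →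
    (L t a (Nat.pair 3 r) ↔ ∃ t', t < t' ∧ t' < n ∧ L t' a r)
  cd1 : ∀ t < n, ∀ a, D t a → ∀ r, Nat.pair 4 r ≤ e →
    (L t a (Nat.pair 4 r) ↔ ∃ b, D t b ∧ b ≠ a ∧ L t b r)

theorem QM.mono' {e n : ℕ} {V : Type} {D : ℕ → V → Prop} {L : ℕ → V → ℕ → Prop}
    (h : QM e n D L) {s t : ℕ} {a : V} (hst : s ≤ t) (ht : t < n) (hs : D s a) : D t a := by
  rcases hst.lt_or_eq with h1 | rfl
  · exact h.mono s t a h1 ht hs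
  · exact hs

theorem right_le_of_pair {i r e : ℕ} (h : Nat.pair i r ≤ e) : r ≤ e :=
  (Nat.right_le_pair i r).trans h

theorem pick_two {V : Type} (S : V → Prop) : ∃ P : Finset V, P.card ≤ 2 ∧ (∀ b ∈ P, S b) ∧
    ∀ a, (∃ b, S b ∧ b ≠ a) → ∃ b ∈ P, b ≠ a := by
  classical
  by_cases h : ∃ x y, S x ∧ S y ∧ x ≠ y
  · obtain ⟨x, y, hx, hy, hxy⟩ := h
    refine ⟨{x, y}, Finset.card_le_two, ?_, ?_⟩
    · intro b hb
      simp only [Finset.mem_insert, Finset.mem_singleton] at hb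
      rcases hb with rfl | rfl <;> assumption
    · intro a _
      by_cases hxa : x = a
      · exact ⟨y, by simp, fun h => hxy (hxa.trans h.symm)⟩
      · exact ⟨x, by simp, hxa⟩
  · push Not at h
    by_cases h0 : ∃ x, S x
    · obtain ⟨x, hx⟩ := h0
      refine ⟨{x}, by simp, by simpa using hx, ?_⟩
      rintro a ⟨b, hb, hba⟩
      exact ⟨x, by simp, by rw [h x b hx hb]; exact hba⟩
    · refine ⟨∅, by simp, by simp, ?_⟩
      rintro a ⟨b, hb, _⟩
      exact absurd ⟨b, hb⟩ h0

/-- Every quasimodel may be pruned to a finite one with controlled growth. -/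
theorem QM.prune {e n : ℕ} {V : Type} {D : ℕ → V → Prop} {L : ℕ → V → ℕ → Prop}
    (h : QM e n D L) : ∃ F : ℕ → Finset V, (∀ t, (F t).card ≤ (2 * e + 3) * (t + 1)) ∧
      QM e n (fun t a => a ∈ F t) L ∧ ∀ s t, s ≤ t → F s ⊆ F t := by
  classical
  obtain ⟨a0, ha0, hroot⟩ := h.root
  choose P hPc hPS hP2 using fun (s r : ℕ) => pick_two (fun b : V => D s b ∧ L s b r)
  set F : ℕ → Finset V := fun t =>
    insert a0 ((Finset.range (t+1)).biUnion fun s => (Finset.range (e+1)).biUnion fun r => P s r)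
    with hF
  have hmem : ∀ t a, a ∈ F t ↔ a = a0 ∨ ∃ s ≤ t, ∃ r ≤ e, a ∈ P s r := by
    intro t a
    simp [hF]
  have hFmono : ∀ s t, s ≤ t → F s ⊆ F t := by
    intro s t hst a ha
    rw [hmem] at ha ⊢
    rcases ha with h1 | ⟨s', hs', r, hr, h1⟩
    · exact Or.inl h1
    · exact Or.inr ⟨s', hs'.trans hst, r, hr, h1⟩
  have hFD : ∀ t < n, ∀ a ∈ F t, D t a := by
    intro t ht a ha
    rw [hmem] at ha
    rcases ha with rfl | ⟨s', hs', r, hr, h1⟩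
    · exact h.mono' (Nat.zero_le _) ht ha0
    · exact h.mono' hs' ht (hPS s' r a h1).1
  refine ⟨F, ?_, ?_, hFmono⟩
  · intro t
    have h1 : (F t).card ≤ ((t+1) * ((e+1) * 2)) + 1 := by
      refine (Finset.card_insert_le _ _).trans (Nat.succ_le_succ ?_)
      refine (Finset.card_biUnion_le_card_mul _ _ ((e+1)*2) ?_).trans (by simp)
      intro s _
      exact (Finset.card_biUnion_le_card_mul _ _ 2 (fun r _ => hPc s r)).trans (by simp)
    nlinarith
  · refine ⟨h.pos, ⟨a0, (hmem _ _).2 (Or.inl rfl), hroot⟩, ?_, ?_, ?_, ?_, ?_⟩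
    · intro s t a hst _ ha
      exact hFmono s t hst.le ha
    · exact fun t ht a ha => h.cneg t ht a (hFD t ht a ha)
    · exact fun t ht a ha => h.cand t ht a (hFD t ht a ha)
    · exact fun t ht a ha => h.cd0 t ht a (hFD t ht a ha)
    · intro t ht a ha r hr
      rw [h.cd1 t ht a (hFD t ht a ha) r hr]
      constructor
      · rintro ⟨b, hb, hba, hbr⟩
        obtain ⟨b', hb', hb'a⟩ := hP2 t r a ⟨b, ⟨hb, hbr⟩, hba⟩
        exact ⟨b', (hmem _ _).2 (Or.inr ⟨t, le_rfl, r, right_le_of_pair hr, hb'⟩), hb'a,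
          (hPS t r b' hb').2⟩
      · rintro ⟨b, hb, hba, hbr⟩
        exact ⟨b, hFD t ht b hb, hba, hbr⟩

/-- Transport of a quasimodel along restriction to a subset containing all the domains. -/
theorem QM.restrict {e n : ℕ} {V : Type} {D : ℕ → V → Prop} {L : ℕ → V → ℕ → Prop}
    (h : QM e n D L) (S : Finset V) (hS : ∀ t < n, ∀ a, D t a → a ∈ S) :
    QM e n (V := {a // a ∈ S}) (fun t a => D t a.1) (fun t a k => L t a.1 k) := by
  refine ⟨h.pos, ?_, fun s t a => h.mono s t a.1, fun t ht a => h.cneg t ht a.1,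
    fun t ht a => h.cand t ht a.1, fun t ht a => h.cd0 t ht a.1, ?_⟩
  · obtain ⟨a, ha, hae⟩ := h.root
    exact ⟨⟨a, hS 0 h.pos a ha⟩, ha, hae⟩
  · intro t ht a ha r hr
    rw [h.cd1 t ht a.1 ha r hr]
    constructor
    · rintro ⟨b, hb, hba, hbr⟩
      exact ⟨⟨b, hS t ht b hb⟩, hb, fun h => hba (congrArg Subtype.val h), hbr⟩
    · rintro ⟨b, hb, hba, hbr⟩
      exact ⟨b.1, hb, fun h => hba (Subtype.ext h), hbr⟩

/-- Shortcutting a quasimodel. -/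
theorem QM.shortcut {e n : ℕ} {V : Type} {D : ℕ → V → Prop} {L : ℕ → V → ℕ → Prop}
    (h : QM e n D L) {i j : ℕ} (hij : i < j) (hj : j < n) (π : V ≃ V)
    (hπ : ∀ a, D i a → D j (π a) ∧ ∀ k ≤ e, (L i a k ↔ L j (π a) k)) :
    QM e (n - (j - i)) (fun t a => if t ≤ i then D t a else D (t + (j - i)) (π a))
      (fun t a k => if t ≤ i then L t a k else L (t + (j - i)) (π a) k) := by
  have hi : i < n := hij.trans hj
  refine ⟨by omega, by simpa using h.root, ?_, ?_, ?_, ?_, ?_⟩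
  · intro s t a hst ht hs
    split_ifs at hs ⊢ with h1 h2 h2
    · exact h.mono s t a hst (by omega) hs
    · omega
    · exact h.mono j _ _ (by omega) (by omega) (hπ a (h.mono' h2 hi hs)).1
    · exact h.mono _ _ _ (by omega) (by omega) hs
  · intro t ht a ha r hr
    split_ifs at ha ⊢ with h1
    · exact h.cneg t (by omega) a ha r hr
    · exact h.cneg _ (by omega) _ ha r hr
  · intro t ht a ha r s hr
    split_ifs at ha ⊢ with h1
    · exact h.cand t (by omega) a ha r s hr
    · exact h.cand _ (by omega) _ ha r s hr
  · intro t ht a ha r hr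
    split_ifs at ha ⊢ with h1
    · have hia := h.mono' h1 hi ha
      obtain ⟨hja, hL⟩ := hπ a hia
      have key : (∃ t', i < t' ∧ t' < n ∧ L t' a r) ↔ (∃ t', j < t' ∧ t' < n ∧ L t' (π a) r) := by
        rw [← h.cd0 i hi a hia r hr, ← h.cd0 j hj _ hja r hr]
        exact hL _ hr
      rw [h.cd0 t (by omega) a ha r hr]
      constructor
      · rintro ⟨t', htt', ht'n, hl⟩
        by_cases hti : t' ≤ i
        · exact ⟨t', htt', by omega, by simpa [hti] using hl⟩
        · obtain ⟨u, hu, hun, hul⟩ := key.1 ⟨t', by omega, ht'n, hl⟩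
          refine ⟨u - (j - i), by omega, by omega, ?_⟩
          rw [if_neg (by omega), Nat.sub_add_cancel (by omega)]
          exact hul
      · rintro ⟨t', htt', ht'n, hl⟩
        split_ifs at hl with hti
        · exact ⟨t', htt', by omega, hl⟩
        · obtain ⟨u, hu, hun, hul⟩ := key.2 ⟨_, by omega, by omega, hl⟩
          exact ⟨u, by omega, hun, hul⟩
    · rw [h.cd0 _ (by omega) _ ha r hr]
      constructor
      · rintro ⟨t', htt', ht'n, hl⟩
        refine ⟨t' - (j - i), by omega, by omega, ?_⟩
        rw [if_neg (by omega), Nat.sub_add_cancel (by omega)]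
        exact hl
      · rintro ⟨t', htt', ht'n, hl⟩
        rw [if_neg (by omega)] at hl
        exact ⟨_, by omega, by omega, hl⟩
  · intro t ht a ha r hr
    split_ifs at ha ⊢ with h1
    · exact h.cd1 t (by omega) a ha r hr
    · rw [h.cd1 _ (by omega) _ ha r hr]
      constructor
      · rintro ⟨b, hb, hba, hbr⟩
        refine ⟨π.symm b, by simpa using hb, ?_, by simpa using hbr⟩
        rintro rfl
        simp at hba
      · rintro ⟨b, hb, hba, hbr⟩
        exact ⟨π b, hb, fun h => hba (π.injective h), hbr⟩

/-- A type-preserving permutation from a comparison of the type counts. -/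
theorem exists_perm {V : Type} [Finite V] {K : Type} (A B : V → Prop) (f g : V → K)
    (hc : ∀ τ, Nat.card {a // A a ∧ f a = τ} ≤ Nat.card {a // B a ∧ g a = τ}) :
    ∃ π : V ≃ V, ∀ a, A a → B (π a) ∧ g (π a) = f a := by
  classical
  have hemb : ∀ τ, Nonempty ({a // A a ∧ f a = τ} ↪ {a // B a ∧ g a = τ}) := by
    intro τ
    have := Fintype.ofFinite V
    apply Function.Embedding.nonempty_of_card_le
    have := hc τ
    rwa [Nat.card_eq_fintype_card, Nat.card_eq_fintype_card] at this
  let G := fun τ => (hemb τ).some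
  have hG : ∀ τ σ (x : {a // A a ∧ f a = τ}) (y : {a // A a ∧ f a = σ}),
      (G τ x).1 = (G σ y).1 → x.1 = y.1 := by
    intro τ σ x y hxy
    have h1 := (G τ x).2.2
    have h2 := (G σ y).2.2
    rw [hxy, h2] at h1
    subst h1
    exact congrArg Subtype.val ((G _).injective (Subtype.ext hxy))
  let F : {a // A a} → V := fun a => (G (f a.1) ⟨a.1, a.2, rfl⟩).1
  have hF : Function.Injective F := by
    intro a b hab
    exact Subtype.ext (hG _ _ _ _ hab)
  let E : {a // A a} ≃ {b // b ∈ Set.range F} := Equiv.ofInjective F hF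
  refine ⟨E.extendSubtype, ?_⟩
  intro a ha
  rw [E.extendSubtype_apply_of_mem a ha]
  exact (G (f a) ⟨a, ha, rfl⟩).2

/-- A controlled bad sequence of length `N` of vectors in dimension `d`. -/
def BadSeq (d C N : ℕ) (x : ℕ → ℕ → ℕ) : Prop :=
  (∀ t < N, ∀ k < d, x t k ≤ C * (t + 1)) ∧ ∀ j < N, ∀ i < j, ∃ k < d, x j k < x i k

/-- Controlled bad sequences have bounded length. -/
theorem exists_no_badSeq (d C : ℕ) : ∃ N, ¬ ∃ x, BadSeq d C N x := by
  by_contra hcon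
  push Not at hcon
  choose X hX using hcon
  let U := Filter.hyperfilter ℕ
  have hev : ∀ i, ∀ᶠ N in (U : Filter ℕ), i < N := by
    intro i
    have h1 : ∀ᶠ N in Filter.atTop, i < N := Filter.eventually_gt_atTop i
    rw [← Nat.cofinite_eq_atTop] at h1
    exact Filter.hyperfilter_le_cofinite h1
  have hlim : ∀ i, ∃ v : Fin d → ℕ, ∀ᶠ N in (U : Filter ℕ), (fun k : Fin d => X N i k) = v := by
    intro i
    have hfin : (Set.Iic (fun _ : Fin d => C * (i+1))).Finite := Set.finite_Iic _
    have h1 : ∀ᶠ N in (U : Filter ℕ),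
        ∃ v ∈ Set.Iic (fun _ : Fin d => C * (i+1)), (fun k : Fin d => X N i k) = v := by
      filter_upwards [hev i] with N hN
      exact ⟨_, fun k => (hX N).1 i hN k k.2, rfl⟩
    rw [Ultrafilter.eventually_exists_mem_iff hfin] at h1
    obtain ⟨v, _, hv⟩ := h1
    exact ⟨v, hv⟩
  choose v hv using hlim
  obtain ⟨i, j, hij, hle⟩ := wellQuasiOrdered_le (α := Fin d → ℕ) v
  obtain ⟨N, hN⟩ := ((hev j).and ((hv i).and (hv j))).exists
  obtain ⟨k, hk, hlt⟩ := (hX N).2 j hN.1 i hij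
  have h1 := congrFun hN.2.1 ⟨k, hk⟩
  have h2 := congrFun hN.2.2 ⟨k, hk⟩
  have h3 : v i ⟨k, hk⟩ ≤ v j ⟨k, hk⟩ := hle ⟨k, hk⟩
  simp only at h1 h2
  omega

/-- If there is a quasimodel, then there is a small one. -/
theorem QM.small {e n : ℕ} {V : Type} {D : ℕ → V → Prop} {L : ℕ → V → ℕ → Prop}
    (h : QM e n D L) {N : ℕ} (hN : ¬ ∃ x, BadSeq (2 ^ (e + 1)) (2 * e + 3) N x) :
    ∃ n < N, ∃ (V : Type) (_ : Fintype V) (D : ℕ → V → Prop) (L : ℕ → V → ℕ → Prop),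
      Fintype.card V ≤ (2 * e + 3) * n ∧ QM e n D L := by
  classical
  have hex : ∃ n, ∃ (V : Type) (D : ℕ → V → Prop) (L : ℕ → V → ℕ → Prop), QM e n D L :=
    ⟨n, V, D, L, h⟩
  obtain ⟨V, D, L, h⟩ := Nat.find_spec hex
  have hmin : ∀ m < Nat.find hex, ¬ ∃ (V : Type) (D : ℕ → V → Prop) (L : ℕ → V → ℕ → Prop),
    QM e m D L := fun m hm => Nat.find_min hex hm
  set n := Nat.find hex
  obtain ⟨F, hFc, hQ, hFm⟩ := h.prune
  have hQ' := hQ.restrict (F (n-1)) (fun t ht a ha => hFm t (n-1) (by omega) ha)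
  have hn := h.pos
  refine ⟨n, ?_, _, inferInstance, _, _, ?_, hQ'⟩
  swap
  · have := hFc (n-1)
    rw [Nat.sub_add_cancel hn] at this
    simpa using this
  by_contra hNn
  push Not at hNn
  apply hN
  let V' := {a // a ∈ F (n-1)}
  have hfinV : Finite V' := inferInstanceAs (Finite {a // a ∈ F (n-1)})
  let eq : (Fin (e+1) → Bool) ≃ Fin (2^(e+1)) := Fintype.equivFinOfCardEq (by simp)
  let ty : ℕ → V' → Fin (2^(e+1)) := fun t a => eq (fun k => decide (L t a.1 k))
  refine ⟨fun t k => Nat.card {a : V' // a.1 ∈ F t ∧ (ty t a : ℕ) = k}, ?_, ?_⟩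
  · intro t ht k _
    refine le_trans ?_ (hFc t)
    have h1 : Nat.card {a // a ∈ F t} = (F t).card := by simp
    rw [← h1]
    exact Nat.card_le_card_of_injective
      (fun a : {a : V' // a.1 ∈ F t ∧ (ty t a : ℕ) = k} => (⟨a.1.1, a.2.1⟩ : {a // a ∈ F t}))
      (fun a b hab => Subtype.ext (Subtype.ext (Subtype.mk.inj hab)))
  · intro j hj i hij
    by_contra hcon
    push Not at hcon
    have hcount : ∀ τ, Nat.card {a : V' // a.1 ∈ F i ∧ ty i a = τ} ≤
        Nat.card {a : V' // a.1 ∈ F j ∧ ty j a = τ} := by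
      intro τ
      have := hcon τ.1 τ.2
      simpa only [← Fin.ext_iff] using this
    obtain ⟨π, hπ⟩ := exists_perm _ _ _ _ hcount
    refine hmin (n - (j - i)) (by omega)
      ⟨_, _, _, hQ'.shortcut hij (by omega : j < n) π ?_⟩
    intro a ha
    refine ⟨(hπ a ha).1, fun k hk => ?_⟩
    have h1 := eq.injective (hπ a ha).2
    have h2 := congrFun h1 ⟨k, by omega⟩
    simp only [decide_eq_decide] at h2
    exact h2.symm

/-! ## Quasimodels and models -/

theorem lt_pair_of_pos {i r : ℕ} (hi : 0 < i) : r < Nat.pair i r := by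
  have := Nat.add_le_pair i r
  omega

theorem unpair_snd_lt {k i : ℕ} (h : k.unpair.1 = i + 1) : k.unpair.2 < k := by
  have h1 := lt_pair_of_pos (r := k.unpair.2) (show 0 < k.unpair.1 by omega)
  rwa [Nat.pair_unpair] at h1

/-- Total decoding of natural numbers to formulas. -/
def decodeB (k : ℕ) : BForm :=
  if h1 : k.unpair.1 = 1 then .neg (decodeB k.unpair.2)
  else if h2 : k.unpair.1 = 2 then
    .and (decodeB k.unpair.2.unpair.1) (decodeB k.unpair.2.unpair.2)
  else if h3 : k.unpair.1 = 3 then .dia0 (decodeB k.unpair.2)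
  else if h4 : k.unpair.1 = 4 then .dia1 (decodeB k.unpair.2)
  else .var k.unpair.2
termination_by k
decreasing_by
  · exact unpair_snd_lt h1
  · exact (Nat.unpair_left_le _).trans_lt (unpair_snd_lt h2)
  · exact (Nat.unpair_right_le _).trans_lt (unpair_snd_lt h2)
  · exact unpair_snd_lt h3
  · exact unpair_snd_lt h4

theorem decodeB_var (r : ℕ) : decodeB (Nat.pair 0 r) = .var r := by
  rw [decodeB]; simp
theorem decodeB_neg (r : ℕ) : decodeB (Nat.pair 1 r) = .neg (decodeB r) := by
  rw [decodeB]; simp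
theorem decodeB_and (r s : ℕ) :
    decodeB (Nat.pair 2 (Nat.pair r s)) = .and (decodeB r) (decodeB s) := by
  rw [decodeB]; simp
theorem decodeB_dia0 (r : ℕ) : decodeB (Nat.pair 3 r) = .dia0 (decodeB r) := by
  rw [decodeB]; simp
theorem decodeB_dia1 (r : ℕ) : decodeB (Nat.pair 4 r) = .dia1 (decodeB r) := by
  rw [decodeB]; simp

theorem decodeB_encodeB (φ : BForm) : decodeB (encodeB φ) = φ := by
  induction φ with
  | var n => simp [encodeB, decodeB_var]
  | neg φ ih => simp [encodeB, decodeB_neg, ih]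
  | and φ ψ ih1 ih2 => simp [encodeB, decodeB_and, ih1, ih2]
  | dia0 φ ih => simp [encodeB, decodeB_dia0, ih]
  | dia1 φ ih => simp [encodeB, decodeB_dia1, ih]

/-- From a model to a quasimodel. -/
theorem exists_QM_of_sat {φ : BForm} (h : ExpDiffSat IsFinLinFrame φ) :
    ∃ (n : ℕ) (V : Type) (D : ℕ → V → Prop) (L : ℕ → V → ℕ → Prop), QM (encodeB φ) n D L := by
  classical
  obtain ⟨T, ⟨hfin, hirr, htr, htri⟩, hexp, hdiff, val, w, hw⟩ := h
  change Finite T.H at hfin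
  change ∀ x : T.H, ¬ T.R x x at hirr
  change ∀ x y z : T.H, T.R x y → T.R y z → T.R x z at htr
  change ∀ x y : T.H, T.R x y ∨ x = y ∨ T.R y x at htri
  have hst : IsStrictTotalOrder T.H T.R :=
    { irrefl := hirr
      trans := htr
      trichotomous := by
        intro a b h1 h2
        rcases htri a b with h | h | h
        · exact absurd h h1
        · exact h
        · exact absurd h h2 }
  let _ := linearOrderOfSTO T.R
  have := Fintype.ofFinite T.H
  obtain ⟨N, hN⟩ : ∃ N, Fintype.card T.H = N := ⟨_, rfl⟩
  let f : Fin N ≃o T.H := Fintype.orderIsoFinOfCardEq T.H hN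
  have hf : ∀ i j : Fin N, T.R (f i) (f j) ↔ i < j := by
    intro i j
    exact f.lt_iff_lt
  obtain ⟨i0, hi0⟩ := f.surjective w.1.1
  obtain ⟨⟨h0, a0⟩, ha0⟩ := w
  simp only at hi0 ha0
  subst hi0
  refine ⟨N - i0, T.V, fun t a => ∃ h : i0 + t < N, a ∈ T.D (f ⟨i0 + t, h⟩),
    fun t a k => ∃ (h : i0 + t < N) (ha : a ∈ T.D (f ⟨i0 + t, h⟩)),
      BSat T.Rh T.Rv val ⟨(f ⟨i0 + t, h⟩, a), ha⟩ (decodeB k), ?_⟩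
  have hi0 := i0.2
  refine ⟨by omega, ⟨a0, ⟨by simp, by simpa using ha0⟩, ⟨by simp, by simpa using ha0, ?_⟩⟩,
    ?_, ?_, ?_, ?_, ?_⟩
  · rw [decodeB_encodeB]
    exact hw
  · rintro s t a hst' ht ⟨h1, h2⟩
    exact ⟨by omega, (hexp _ _ ((hf _ _).2 (by simpa using hst'))).1 h2⟩
  · rintro t ht a ⟨h1, h2⟩ r hr
    rw [decodeB_neg]
    simp [BSat, h1, h2]
  · rintro t ht a ⟨h1, h2⟩ r s hr
    rw [decodeB_and]
    simp [BSat, h1, h2]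
  · rintro t ht a ⟨h1, h2⟩ r hr
    rw [decodeB_dia0]
    constructor
    · rintro ⟨_, _, ⟨⟨x, b⟩, hb⟩, ⟨hR, hab⟩, hs⟩
      obtain ⟨i, rfl⟩ := f.surjective x
      simp only at hR hab
      subst hab
      rw [hf] at hR
      have hlt : i0 + t < i := hR
      refine ⟨i - i0, by omega, by omega, ?_⟩
      have hii : f ⟨i0 + (i - i0), by omega⟩ = f i := by
        congr 1
        ext
        simp only
        omega
      have hi : i = ⟨i0 + (i - i0), by omega⟩ := by
        ext
        simp only
        omega
      have gen : ∀ (i' : Fin N), i = i' → ∃ ha : a ∈ T.D (f i'),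
          BSat T.Rh T.Rv val ⟨(f i', a), ha⟩ (decodeB r) := by
        rintro _ rfl
        exact ⟨hb, hs⟩
      exact ⟨by omega, gen _ hi⟩
    · rintro ⟨t', htt', ht', h3, h4, hs⟩
      exact ⟨h1, h2, ⟨(f ⟨i0 + t', h3⟩, a), h4⟩, ⟨(hf _ _).2 (by simpa using htt'), rfl⟩, hs⟩
  · rintro t ht a ⟨h1, h2⟩ r hr
    rw [decodeB_dia1]
    constructor
    · rintro ⟨_, _, ⟨⟨x, b⟩, hb⟩, ⟨hx, hS⟩, hs⟩
      simp only at hx hS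
      subst hx
      exact ⟨b, ⟨h1, hb⟩, fun h => (hdiff _ _ h2 _ hb).1 hS h.symm, h1, hb, hs⟩
    · rintro ⟨b, ⟨h3, h4⟩, hne, h5, h6, hs⟩
      exact ⟨h1, h2, ⟨(f ⟨i0 + t, h1⟩, b), h4⟩,
        ⟨rfl, (hdiff _ _ h2 _ h4).2 (Ne.symm hne)⟩, hs⟩

/-- From a quasimodel to a model. -/
theorem sat_of_QM {φ : BForm} {n : ℕ} {V : Type} {D : ℕ → V → Prop} {L : ℕ → V → ℕ → Prop}
    (h : QM (encodeB φ) n D L) : ExpDiffSat IsFinLinFrame φ := by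
  obtain ⟨a0, ha0, hroot⟩ := h.root
  let T : TwoFrame :=
    { H := Fin n
      R := fun i j => i < j
      Hne := ⟨⟨0, h.pos⟩⟩
      V := V
      D := fun t => {a | D t a}
      S := fun _ a b => a ≠ b
      Dne := fun t => ⟨a0, h.mono' (Nat.zero_le _) t.2 ha0⟩ }
  let val : ℕ → T.Worlds → Prop := fun k w => L (w.1.1 : Fin n) w.1.2 (Nat.pair 0 k)
  have key : ∀ ψ : BForm, encodeB ψ ≤ encodeB φ → ∀ (t : Fin n) (a : V) (ha : D t a),
      BSat T.Rh T.Rv val ⟨(t, a), ha⟩ ψ ↔ L t a (encodeB ψ) := by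
    intro ψ
    induction ψ with
    | var k =>
      intro _ t a ha
      exact Iff.rfl
    | neg ψ ih =>
      intro hle t a ha
      simp only [encodeB] at hle ⊢
      rw [h.cneg t t.2 a ha _ hle, ← ih (right_le_of_pair hle) t a ha]
      exact Iff.rfl
    | and ψ χ ih1 ih2 =>
      intro hle t a ha
      simp only [encodeB] at hle ⊢
      have h1 := right_le_of_pair hle
      rw [h.cand t t.2 a ha _ _ hle, ← ih1 ((Nat.left_le_pair _ _).trans h1) t a ha,
        ← ih2 ((Nat.right_le_pair _ _).trans h1) t a ha]
      exact Iff.rfl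
    | dia0 ψ ih =>
      intro hle t a ha
      simp only [encodeB] at hle ⊢
      rw [h.cd0 t t.2 a ha _ hle]
      constructor
      · rintro ⟨⟨⟨t', b⟩, hb⟩, ⟨hR, hab⟩, hs⟩
        simp only at hab
        subst hab
        exact ⟨(t' : Fin n), hR, (t' : Fin n).2, (ih (right_le_of_pair hle) t' a hb).1 hs⟩
      · rintro ⟨t', htt', ht', hl⟩
        have hb : D t' a := h.mono _ _ _ htt' ht' ha
        exact ⟨⟨((⟨t', ht'⟩ : Fin n), a), hb⟩, ⟨htt', rfl⟩,
          (ih (right_le_of_pair hle) ⟨t', ht'⟩ a hb).2 hl⟩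
    | dia1 ψ ih =>
      intro hle t a ha
      simp only [encodeB] at hle ⊢
      rw [h.cd1 t t.2 a ha _ hle]
      constructor
      · rintro ⟨⟨⟨t', b⟩, hb⟩, ⟨hR, hab⟩, hs⟩
        simp only at hR
        subst hR
        exact ⟨b, hb, Ne.symm hab, (ih (right_le_of_pair hle) t b hb).1 hs⟩
      · rintro ⟨b, hb, hba, hl⟩
        exact ⟨⟨(t, b), hb⟩, ⟨rfl, Ne.symm hba⟩, (ih (right_le_of_pair hle) t b hb).2 hl⟩
  refine ⟨T, ⟨inferInstanceAs (Finite (Fin n)), ?_, ?_, ?_⟩, ?_, ?_, val,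
    ⟨((⟨0, h.pos⟩ : Fin n), a0), ha0⟩, (key φ le_rfl ⟨0, h.pos⟩ a0 ha0).2 hroot⟩
  · exact fun x : Fin n => lt_irrefl x
  · exact fun x y z : Fin n => lt_trans
  · exact fun x y : Fin n => lt_trichotomy x y
  · intro x y hxy
    exact ⟨fun a ha => h.mono _ _ a hxy (y : Fin n).2 ha, fun a _ b _ => Iff.rfl⟩
  · intro x a _ b _
    exact Iff.rfl

/-! ## Coding of finite tables -/

/-- The `i`-th base-`M` digit of `c`. -/
def entry (M c i : ℕ) : ℕ := c / M ^ i % M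

theorem exists_code (M : ℕ) (hM : 0 < M) (K : ℕ) (f : ℕ → ℕ) (hf : ∀ i < K, f i < M) :
    ∃ c < M ^ K, ∀ i < K, entry M c i = f i := by
  induction K with
  | zero => exact ⟨0, by simp, by simp⟩
  | succ K ih =>
    obtain ⟨c, hc, h⟩ := ih (fun i hi => hf i (by omega))
    refine ⟨c + M ^ K * f K, ?_, ?_⟩
    · have := hf K (by omega)
      calc c + M ^ K * f K < M ^ K + M ^ K * f K := by omega
        _ = M ^ K * (f K + 1) := by ring
        _ ≤ M ^ K * M := Nat.mul_le_mul_left _ this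
        _ = M ^ (K + 1) := (pow_succ _ _).symm
    · intro i hi
      have hpos : 0 < M ^ i := Nat.pow_pos hM
      rcases Nat.lt_succ_iff_lt_or_eq.1 hi with h1 | rfl
      · rw [← h i h1]
        obtain ⟨j, rfl⟩ := Nat.exists_eq_add_of_lt h1
        have h2 : c + M ^ (i + j + 1) * f (i + j + 1) =
            c + M ^ i * (M * (M ^ j * f (i + j + 1))) := by ring
        unfold entry
        rw [h2, Nat.add_mul_div_left _ _ hpos, Nat.add_mul_mod_self_left]
      · unfold entry
        rw [Nat.add_mul_div_left _ _ hpos, Nat.div_eq_of_lt hc, zero_add,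
          Nat.mod_eq_of_lt (hf i (by omega))]

theorem exists_bits (K : ℕ) (p : ℕ → Prop) :
    ∃ c < 2 ^ K, ∀ i < K, (entry 2 c i = 1 ↔ p i) := by
  classical
  obtain ⟨c, hc, h⟩ := exists_code 2 (by simp) K (fun i => if p i then 1 else 0)
    (fun i _ => by split_ifs <;> simp)
  refine ⟨c, hc, fun i hi => ?_⟩
  rw [h i hi]
  split_ifs with h1 <;> simp [h1]

theorem pair_lt_pair {a b c d : ℕ} (h1 : a < c) (h2 : b < d) : Nat.pair a b < Nat.pair c d :=
  (Nat.pair_lt_pair_left b h1).trans (Nat.pair_lt_pair_right c h2)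

/-- Bad sequences coded by numbers. -/
def BadCode (d C N c : ℕ) : Prop :=
  BadSeq d C N (fun t k => entry (C * N + 1) c (Nat.pair t k))

theorem exists_badCode_iff (d C N : ℕ) :
    (∃ c < (C * N + 1) ^ (Nat.pair N d), BadCode d C N c) ↔ ∃ x, BadSeq d C N x := by
  constructor
  · rintro ⟨c, _, hc⟩
    exact ⟨_, hc⟩
  · rintro ⟨x, hx1, hx2⟩
    have hb : ∀ t < N, ∀ k < d, x t k < C * N + 1 := by
      intro t ht k hk
      have h1 := hx1 t ht k hk
      have h2 : C * (t + 1) ≤ C * N := Nat.mul_le_mul_left _ ht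
      omega
    obtain ⟨c, hc, h⟩ := exists_code (C * N + 1) (by omega) (Nat.pair N d)
      (fun i => min (x i.unpair.1 i.unpair.2) (C * N)) (fun i _ => by simp)
    have hval : ∀ t < N, ∀ k < d, entry (C * N + 1) c (Nat.pair t k) = x t k := by
      intro t ht k hk
      rw [h _ (pair_lt_pair ht hk)]
      have := hb t ht k hk
      simp only [Nat.unpair_pair]
      omega
    refine ⟨c, hc, ?_, ?_⟩
    · intro t ht k hk
      simp only [hval t ht k hk]
      exact hx1 t ht k hk
    · intro j hj i hij
      obtain ⟨k, hk, hlt⟩ := hx2 j hj i hij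
      refine ⟨k, hk, ?_⟩
      simp only [hval j hj k hk, hval i (hij.trans hj) k hk]
      exact hlt

/-- The bit of the table `c` at `(t, a, k)`. -/
def TB (c t a k : ℕ) : Prop := entry 2 c (Nat.pair t (Nat.pair a k)) = 1

/-- `c` codes a quasimodel of length `n` on the points below `m`. -/
def ModelCode (e n m c : ℕ) : Prop :=
  0 < n ∧ (∃ a < m, TB c 0 a (e + 1) ∧ TB c 0 a e) ∧
  ∀ t < n, ∀ a < m, TB c t a (e + 1) →
    (∀ s < n, t < s → TB c s a (e + 1)) ∧
    (∀ r < e + 1, Nat.pair 1 r ≤ e → (TB c t a (Nat.pair 1 r) ↔ ¬ TB c t a r)) ∧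
    (∀ r < e + 1, ∀ s < e + 1, Nat.pair 2 (Nat.pair r s) ≤ e →
      (TB c t a (Nat.pair 2 (Nat.pair r s)) ↔ TB c t a r ∧ TB c t a s)) ∧
    (∀ r < e + 1, Nat.pair 3 r ≤ e →
      (TB c t a (Nat.pair 3 r) ↔ ∃ t' < n, t < t' ∧ TB c t' a r)) ∧
    (∀ r < e + 1, Nat.pair 4 r ≤ e →
      (TB c t a (Nat.pair 4 r) ↔ ∃ b < m, TB c t b (e + 1) ∧ b ≠ a ∧ TB c t b r))

theorem QM_of_modelCode {e n m c : ℕ} (h : ModelCode e n m c) :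
    QM e n (V := ℕ) (fun t a => a < m ∧ TB c t a (e + 1)) (fun t a k => TB c t a k) := by
  obtain ⟨h0, ⟨a, ha, har, hae⟩, h⟩ := h
  refine ⟨h0, ⟨a, ⟨ha, har⟩, hae⟩, ?_, ?_, ?_, ?_, ?_⟩
  · rintro s t a hst ht ⟨h1, h2⟩
    exact ⟨h1, (h s (hst.trans ht) a h1 h2).1 t ht hst⟩
  · rintro t ht a ⟨h1, h2⟩ r hr
    exact (h t ht a h1 h2).2.1 r (Nat.lt_succ_of_le (right_le_of_pair hr)) hr
  · rintro t ht a ⟨h1, h2⟩ r s hr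
    have h3 := right_le_of_pair hr
    exact (h t ht a h1 h2).2.2.1 r (Nat.lt_succ_of_le ((Nat.left_le_pair _ _).trans h3)) s
      (Nat.lt_succ_of_le ((Nat.right_le_pair _ _).trans h3)) hr
  · rintro t ht a ⟨h1, h2⟩ r hr
    rw [(h t ht a h1 h2).2.2.2.1 r (Nat.lt_succ_of_le (right_le_of_pair hr)) hr]
    exact exists_congr fun t' => by tauto
  · rintro t ht a ⟨h1, h2⟩ r hr
    rw [(h t ht a h1 h2).2.2.2.2 r (Nat.lt_succ_of_le (right_le_of_pair hr)) hr]
    exact exists_congr fun t' => by tauto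

theorem modelCode_of_QM {e n m : ℕ} {V : Type} [Fintype V] {D : ℕ → V → Prop}
    {L : ℕ → V → ℕ → Prop} (h : QM e n D L) (hm : Fintype.card V ≤ m) :
    ∃ c < 2 ^ (Nat.pair n (Nat.pair m (e + 2))), ModelCode e n m c := by
  classical
  obtain ⟨f⟩ : Nonempty (V ↪ Fin m) :=
    Function.Embedding.nonempty_of_card_le (by simpa using hm)
  obtain ⟨c, hc, hp⟩ := exists_bits (Nat.pair n (Nat.pair m (e + 2)))
    (fun i => ∃ a : V, (f a : ℕ) = i.unpair.2.unpair.1 ∧ D i.unpair.1 a ∧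
      (i.unpair.2.unpair.2 ≤ e → L i.unpair.1 a i.unpair.2.unpair.2))
  have hTB0 : ∀ t < n, ∀ a < m, ∀ k < e + 2, (TB c t a k ↔
      ∃ a' : V, (f a' : ℕ) = a ∧ D t a' ∧ (k ≤ e → L t a' k)) := by
    intro t ht a ha k hk
    unfold TB
    rw [hp _ (pair_lt_pair ht (pair_lt_pair ha hk))]
    simp
  have hD0 : ∀ t < n, ∀ a < m, TB c t a (e + 1) → ∃ a' : V, (f a' : ℕ) = a ∧ D t a' := by
    intro t ht a ha h1
    rw [hTB0 t ht a ha _ (by omega)] at h1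
    obtain ⟨a', h2, h3, _⟩ := h1
    exact ⟨a', h2, h3⟩
  have hD : ∀ t < n, ∀ a : V, (TB c t (f a) (e + 1) ↔ D t a) := by
    intro t ht a
    rw [hTB0 t ht _ (f a).2 _ (by omega)]
    constructor
    · rintro ⟨a', h2, h3, _⟩
      rwa [← f.injective (Fin.ext h2)]
    · intro h1
      exact ⟨a, rfl, h1, by omega⟩
  have hL : ∀ t < n, ∀ a : V, D t a → ∀ k ≤ e, (TB c t (f a) k ↔ L t a k) := by
    intro t ht a ha k hk
    rw [hTB0 t ht _ (f a).2 _ (by omega)]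
    constructor
    · rintro ⟨a', h2, h3, h4⟩
      rw [← f.injective (Fin.ext h2)]
      exact h4 hk
    · intro h1
      exact ⟨a, rfl, ha, fun _ => h1⟩
  refine ⟨c, hc, h.pos, ?_, ?_⟩
  · obtain ⟨a, ha, hae⟩ := h.root
    exact ⟨f a, (f a).2, (hD 0 h.pos a).2 ha, (hL 0 h.pos a ha e le_rfl).2 hae⟩
  · intro t ht a ha hTa
    obtain ⟨a, rfl, hDa⟩ := hD0 t ht a ha hTa
    refine ⟨?_, ?_, ?_, ?_, ?_⟩
    · intro s hs hts
      exact (hD s hs a).2 (h.mono t s a hts hs hDa)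
    · intro r _ hr
      rw [hL t ht a hDa _ hr, hL t ht a hDa _ (right_le_of_pair hr)]
      exact h.cneg t ht a hDa r hr
    · intro r hr' s hs' hr
      rw [hL t ht a hDa _ hr, hL t ht a hDa _ (by omega), hL t ht a hDa _ (by omega)]
      exact h.cand t ht a hDa r s hr
    · intro r hr' hr
      rw [hL t ht a hDa _ hr, h.cd0 t ht a hDa r hr]
      constructor
      · rintro ⟨t', h1, h2, h3⟩
        exact ⟨t', h2, h1, (hL t' h2 a (h.mono _ _ _ h1 h2 hDa) r (by omega)).2 h3⟩
      · rintro ⟨t', h2, h1, h3⟩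
        exact ⟨t', h1, h2, (hL t' h2 a (h.mono _ _ _ h1 h2 hDa) r (by omega)).1 h3⟩
    · intro r hr' hr
      rw [hL t ht a hDa _ hr, h.cd1 t ht a hDa r hr]
      constructor
      · rintro ⟨b, h1, h2, h3⟩
        exact ⟨f b, (f b).2, (hD t ht b).2 h1, fun h4 => h2 (f.injective (Fin.ext h4)),
          (hL t ht b h1 r (by omega)).2 h3⟩
      · rintro ⟨b, h1, h2, h3, h4⟩
        obtain ⟨b, rfl, hDb⟩ := hD0 t ht b h1 h2
        exact ⟨b, hDb, fun h5 => h3 (by rw [h5]), (hL t ht b hDb r (by omega)).1 h4⟩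

/-- `v` witnesses that `e` is the code of a formula. -/
def ValidCode (e v : ℕ) : Prop :=
  entry 2 v e = 1 ∧ ∀ k < e + 1, entry 2 v k = 1 →
    (k.unpair.1 = 0 ∨ ((k.unpair.1 = 1 ∨ k.unpair.1 = 3 ∨ k.unpair.1 = 4) ∧
        entry 2 v k.unpair.2 = 1) ∨
      (k.unpair.1 = 2 ∧ entry 2 v k.unpair.2.unpair.1 = 1 ∧
        entry 2 v k.unpair.2.unpair.2 = 1))

theorem validCode_iff (e : ℕ) : (∃ v < 2 ^ (e + 1), ValidCode e v) ↔ ∃ φ, encodeB φ = e := by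
  constructor
  · rintro ⟨v, _, h0, h⟩
    have key : ∀ k, k < e + 1 → entry 2 v k = 1 → ∃ φ, encodeB φ = k := by
      intro k
      induction k using Nat.strong_induction_on with
      | _ k ih =>
        intro hk hv
        have hp := Nat.pair_unpair k
        rcases h k hk hv with h1 | ⟨h1, h2⟩ | ⟨h1, h2, h3⟩
        · rw [h1] at hp
          exact ⟨.var k.unpair.2, hp⟩
        · have hlt : k.unpair.2 < k := by
            rcases h1 with h1 | h1 | h1 <;> exact unpair_snd_lt h1
          obtain ⟨ψ, hψ⟩ := ih _ hlt (by omega) h2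
          rcases h1 with h1 | h1 | h1 <;> rw [h1, ← hψ] at hp
          · exact ⟨.neg ψ, hp⟩
          · exact ⟨.dia0 ψ, hp⟩
          · exact ⟨.dia1 ψ, hp⟩
        · have hlt : k.unpair.2 < k := unpair_snd_lt h1
          have l1 := Nat.unpair_left_le k.unpair.2
          have l2 := Nat.unpair_right_le k.unpair.2
          obtain ⟨ψ, hψ⟩ := ih _ (l1.trans_lt hlt) (by omega) h2
          obtain ⟨χ, hχ⟩ := ih _ (l2.trans_lt hlt) (by omega) h3
          have hp2 := Nat.pair_unpair k.unpair.2
          rw [← hψ, ← hχ] at hp2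
          rw [h1, ← hp2] at hp
          exact ⟨.and ψ χ, hp⟩
    exact key e (by omega) h0
  · rintro ⟨φ, rfl⟩
    obtain ⟨v, hv, h⟩ := exists_bits (encodeB φ + 1) (fun k => ∃ ψ, encodeB ψ = k)
    refine ⟨v, hv, (h _ (by omega)).2 ⟨φ, rfl⟩, ?_⟩
    intro k hk hvk
    obtain ⟨ψ, rfl⟩ := (h k hk).1 hvk
    cases ψ with
    | var n => left; simp [encodeB]
    | neg ψ =>
      right; left
      simp only [encodeB, Nat.unpair_pair] at hk ⊢
      have := Nat.right_le_pair 1 (encodeB ψ)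
      exact ⟨by simp, (h _ (by omega)).2 ⟨_, rfl⟩⟩
    | and ψ χ =>
      right; right
      simp only [encodeB, Nat.unpair_pair] at hk ⊢
      have := Nat.right_le_pair 2 (Nat.pair (encodeB ψ) (encodeB χ))
      have := Nat.right_le_pair (encodeB ψ) (encodeB χ)
      have := Nat.left_le_pair (encodeB ψ) (encodeB χ)
      exact ⟨trivial, (h _ (by omega)).2 ⟨_, rfl⟩, (h _ (by omega)).2 ⟨_, rfl⟩⟩
    | dia0 ψ =>
      right; left
      simp only [encodeB, Nat.unpair_pair] at hk ⊢
      have := Nat.right_le_pair 3 (encodeB ψ)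
      exact ⟨by simp, (h _ (by omega)).2 ⟨_, rfl⟩⟩
    | dia1 ψ =>
      right; left
      simp only [encodeB, Nat.unpair_pair] at hk ⊢
      have := Nat.right_le_pair 4 (encodeB ψ)
      exact ⟨by simp, (h _ (by omega)).2 ⟨_, rfl⟩⟩

/-! ## Computability -/

section Comp

variable {α : Type} [Primcodable α]

theorem pr_forall {f : α → ℕ} {p : α → ℕ → Prop} (hf : Primrec f)
    (hp : PrimrecPred fun x : α × ℕ => p x.1 x.2) : PrimrecPred fun a => ∀ x < f a, p a x := by
  have h1 : PrimrecRel (fun (x : ℕ) (a : α) => p a x) :=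
    hp.comp (Primrec.pair Primrec.snd Primrec.fst)
  exact (h1.forall_mem_list.comp (Primrec.list_range.comp hf) Primrec.id).of_eq fun a => by simp

theorem pr_exists {f : α → ℕ} {p : α → ℕ → Prop} (hf : Primrec f)
    (hp : PrimrecPred fun x : α × ℕ => p x.1 x.2) : PrimrecPred fun a => ∃ x < f a, p a x := by
  have h1 : PrimrecRel (fun (x : ℕ) (a : α) => p a x) :=
    hp.comp (Primrec.pair Primrec.snd Primrec.fst)
  exact (h1.exists_mem_list.comp (Primrec.list_range.comp hf) Primrec.id).of_eq fun a => by simp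

theorem pr_imp {p q : α → Prop} (hp : PrimrecPred p) (hq : PrimrecPred q) :
    PrimrecPred fun a => p a → q a :=
  (hp.not.or hq).of_eq fun a => by tauto

theorem pr_iff {p q : α → Prop} (hp : PrimrecPred p) (hq : PrimrecPred q) :
    PrimrecPred fun a => (p a ↔ q a) :=
  ((pr_imp hp hq).and (pr_imp hq hp)).of_eq fun a => by tauto

theorem pr_pow {f g : α → ℕ} (hf : Primrec f) (hg : Primrec g) :
    Primrec fun a => f a ^ g a := by
  have h2 : Primrec₂ (fun (a : α) (p : ℕ × ℕ) => p.2 * f a) :=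
    Primrec.nat_mul.comp (Primrec.snd.comp Primrec.snd) (hf.comp Primrec.fst)
  have h1 : Primrec fun a => Nat.rec (motive := fun _ => ℕ) 1 (fun _ y => y * f a) (g a) :=
    Primrec.nat_rec' hg (Primrec.const 1) h2
  refine h1.of_eq fun a => ?_
  induction g a with
  | zero => rfl
  | succ n ih => rw [pow_succ, ← ih]

theorem pr_entry {f g h : α → ℕ} (hf : Primrec f) (hg : Primrec g) (hh : Primrec h) :
    Primrec fun a => entry (f a) (g a) (h a) :=
  Primrec.nat_mod.comp (Primrec.nat_div.comp hg (pr_pow hf hh)) hf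

theorem pr_pair {f g : α → ℕ} (hf : Primrec f) (hg : Primrec g) :
    Primrec fun a => Nat.pair (f a) (g a) := Primrec₂.natPair.comp hf hg

theorem pr_add {f g : α → ℕ} (hf : Primrec f) (hg : Primrec g) :
    Primrec fun a => f a + g a := Primrec.nat_add.comp hf hg

theorem pr_mul {f g : α → ℕ} (hf : Primrec f) (hg : Primrec g) :
    Primrec fun a => f a * g a := Primrec.nat_mul.comp hf hg

theorem pr_lt {f g : α → ℕ} (hf : Primrec f) (hg : Primrec g) :
    PrimrecPred fun a => f a < g a := Primrec.nat_lt.comp hf hg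

theorem pr_le {f g : α → ℕ} (hf : Primrec f) (hg : Primrec g) :
    PrimrecPred fun a => f a ≤ g a := Primrec.nat_le.comp hf hg

theorem pr_eq {f g : α → ℕ} (hf : Primrec f) (hg : Primrec g) :
    PrimrecPred fun a => f a = g a := Primrec.eq.comp hf hg

theorem pr_unpair1 {f : α → ℕ} (hf : Primrec f) : Primrec fun a => (f a).unpair.1 :=
  Primrec.fst.comp (Primrec.unpair.comp hf)

theorem pr_unpair2 {f : α → ℕ} (hf : Primrec f) : Primrec fun a => (f a).unpair.2 :=
  Primrec.snd.comp (Primrec.unpair.comp hf)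

theorem pr_TB {c t a k : α → ℕ} (hc : Primrec c) (ht : Primrec t) (ha : Primrec a)
    (hk : Primrec k) : PrimrecPred fun x => TB (c x) (t x) (a x) (k x) :=
  pr_eq (pr_entry (Primrec.const 2) hc (pr_pair ht (pr_pair ha hk))) (Primrec.const 1)

/-- Lifting a primitive recursive function to an extended context. -/
theorem pr_lift {f : α → ℕ} (hf : Primrec f) : Primrec fun x : α × ℕ => f x.1 :=
  hf.comp Primrec.fst

/-- The last variable of an extended context. -/
theorem pr_last : Primrec fun x : α × ℕ => x.2 := Primrec.snd

theorem pr_one {f : α → ℕ} (hf : Primrec f) : Primrec fun x => f x + 1 :=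
  Primrec.succ.comp hf

theorem pr_validCode {e v : α → ℕ} (he : Primrec e) (hv : Primrec v) :
    PrimrecPred fun x => ValidCode (e x) (v x) := by
  have c0 : ∀ n : ℕ, Primrec fun _ : α × ℕ => n := fun n => Primrec.const n
  have hk : Primrec fun x : α × ℕ => x.2 := pr_last
  have hv' := pr_lift hv
  refine (pr_eq (pr_entry (Primrec.const 2) hv he) (Primrec.const 1)).and
    (pr_forall (pr_one he) (pr_imp (pr_eq (pr_entry (c0 2) hv' hk) (c0 1)) ?_))
  refine (pr_eq (pr_unpair1 hk) (c0 0)).or (.or (.and (.or ?_ (.or ?_ ?_)) ?_)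
    (.and ?_ (.and ?_ ?_)))
  · exact pr_eq (pr_unpair1 hk) (c0 1)
  · exact pr_eq (pr_unpair1 hk) (c0 3)
  · exact pr_eq (pr_unpair1 hk) (c0 4)
  · exact pr_eq (pr_entry (c0 2) hv' (pr_unpair2 hk)) (c0 1)
  · exact pr_eq (pr_unpair1 hk) (c0 2)
  · exact pr_eq (pr_entry (c0 2) hv' (pr_unpair1 (pr_unpair2 hk))) (c0 1)
  · exact pr_eq (pr_entry (c0 2) hv' (pr_unpair2 (pr_unpair2 hk))) (c0 1)

theorem pr_badCode {d C N c : α → ℕ} (hd : Primrec d) (hC : Primrec C) (hN : Primrec N)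
    (hc : Primrec c) : PrimrecPred fun x => BadCode (d x) (C x) (N x) (c x) := by
  have hM := pr_one (pr_mul hC hN)
  refine (pr_forall hN (pr_forall (pr_lift hd) ?_)).and
    (pr_forall hN (pr_forall pr_last (pr_exists (pr_lift (pr_lift hd)) ?_)))
  · exact pr_le (pr_entry (pr_lift (pr_lift hM)) (pr_lift (pr_lift hc))
      (pr_pair (pr_lift pr_last) pr_last)) (pr_mul (pr_lift (pr_lift hC)) (pr_one (pr_lift pr_last)))
  · have h1 := pr_lift (pr_lift (pr_lift hM))
    have h2 := pr_lift (pr_lift (pr_lift hc))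
    exact pr_lt (pr_entry h1 h2 (pr_pair (pr_lift (pr_lift pr_last)) pr_last))
      (pr_entry h1 h2 (pr_pair (pr_lift pr_last) pr_last))

/-- The context `(parameters, t, a, r)` for one clause of `ModelCode`. -/
theorem pr_clause_and {e t a c : α → ℕ} (he : Primrec e) (ht : Primrec t) (ha : Primrec a)
    (hc : Primrec c) : PrimrecPred fun x => ∀ r < e x + 1, ∀ s < e x + 1,
      Nat.pair 2 (Nat.pair r s) ≤ e x → (TB (c x) (t x) (a x) (Nat.pair 2 (Nat.pair r s)) ↔
        TB (c x) (t x) (a x) r ∧ TB (c x) (t x) (a x) s) := by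
  have hr : Primrec fun x : (α × ℕ) × ℕ => x.1.2 := pr_lift pr_last
  have hs : Primrec fun x : (α × ℕ) × ℕ => x.2 := pr_last
  have hp : Primrec fun x : (α × ℕ) × ℕ => Nat.pair 2 (Nat.pair x.1.2 x.2) :=
    pr_pair (Primrec.const 2) (pr_pair hr hs)
  have he2 : Primrec fun x : (α × ℕ) × ℕ => e x.1.1 := pr_lift (pr_lift he)
  have hc2 : Primrec fun x : (α × ℕ) × ℕ => c x.1.1 := pr_lift (pr_lift hc)
  have ht2 : Primrec fun x : (α × ℕ) × ℕ => t x.1.1 := pr_lift (pr_lift ht)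
  have ha2 : Primrec fun x : (α × ℕ) × ℕ => a x.1.1 := pr_lift (pr_lift ha)
  have h1 := pr_le hp he2
  have h2 := pr_TB hc2 ht2 ha2 hp
  have h3 := (pr_TB hc2 ht2 ha2 hr).and (pr_TB hc2 ht2 ha2 hs)
  have h4 := pr_imp h1 (pr_iff h2 h3)
  refine pr_forall (pr_one he) (pr_forall (pr_one (pr_lift he)) ?_)
  exact h4

theorem pr_clause_not {e t a c : α → ℕ} (he : Primrec e) (ht : Primrec t) (ha : Primrec a)
    (hc : Primrec c) : PrimrecPred fun x => ∀ r < e x + 1, Nat.pair 1 r ≤ e x →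
      (TB (c x) (t x) (a x) (Nat.pair 1 r) ↔ ¬ TB (c x) (t x) (a x) r) := by
  have hr : Primrec fun x : α × ℕ => x.2 := pr_last
  have hp : Primrec fun x : α × ℕ => Nat.pair 1 x.2 := pr_pair (Primrec.const 1) hr
  have h1 := pr_le hp (pr_lift he)
  have h2 := pr_TB (pr_lift hc) (pr_lift ht) (pr_lift ha) hp
  have h3 := (pr_TB (pr_lift hc) (pr_lift ht) (pr_lift ha) hr).not
  have h4 := pr_imp h1 (pr_iff h2 h3)
  refine pr_forall (pr_one he) ?_
  exact h4

theorem pr_clause_dia0 {e n t a c : α → ℕ} (he : Primrec e) (hn : Primrec n) (ht : Primrec t)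
    (ha : Primrec a) (hc : Primrec c) : PrimrecPred fun x => ∀ r < e x + 1, Nat.pair 3 r ≤ e x →
      (TB (c x) (t x) (a x) (Nat.pair 3 r) ↔ ∃ t' < n x, t x < t' ∧ TB (c x) t' (a x) r) := by
  have hr : Primrec fun x : α × ℕ => x.2 := pr_last
  have hp : Primrec fun x : α × ℕ => Nat.pair 3 x.2 := pr_pair (Primrec.const 3) hr
  have hs : Primrec fun x : (α × ℕ) × ℕ => x.2 := pr_last
  have h1 := pr_le hp (pr_lift he)
  have h2 := pr_TB (pr_lift hc) (pr_lift ht) (pr_lift ha) hp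
  have h3 : PrimrecPred fun x : α × ℕ => ∃ t' < n x.1, t x.1 < t' ∧ TB (c x.1) t' (a x.1) x.2 := by
    refine pr_exists (pr_lift hn) ?_
    have h5 := pr_lt (pr_lift (pr_lift ht)) hs
    have h6 := pr_TB (pr_lift (pr_lift hc)) hs (pr_lift (pr_lift ha)) (pr_lift hr)
    exact h5.and h6
  have h4 := pr_imp h1 (pr_iff h2 h3)
  refine pr_forall (pr_one he) ?_
  exact h4

theorem pr_clause_dia1 {e m t a c : α → ℕ} (he : Primrec e) (hm : Primrec m) (ht : Primrec t)
    (ha : Primrec a) (hc : Primrec c) : PrimrecPred fun x => ∀ r < e x + 1, Nat.pair 4 r ≤ e x →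
      (TB (c x) (t x) (a x) (Nat.pair 4 r) ↔ ∃ b < m x, TB (c x) (t x) b (e x + 1) ∧
        b ≠ a x ∧ TB (c x) (t x) b r) := by
  have hr : Primrec fun x : α × ℕ => x.2 := pr_last
  have hp : Primrec fun x : α × ℕ => Nat.pair 4 x.2 := pr_pair (Primrec.const 4) hr
  have hs : Primrec fun x : (α × ℕ) × ℕ => x.2 := pr_last
  have h1 := pr_le hp (pr_lift he)
  have h2 := pr_TB (pr_lift hc) (pr_lift ht) (pr_lift ha) hp
  have h3 : PrimrecPred fun x : α × ℕ => ∃ b < m x.1, TB (c x.1) (t x.1) b (e x.1 + 1) ∧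
        b ≠ a x.1 ∧ TB (c x.1) (t x.1) b x.2 := by
    refine pr_exists (pr_lift hm) ?_
    have h5 := pr_TB (pr_lift (pr_lift hc)) (pr_lift (pr_lift ht)) hs (pr_one (pr_lift (pr_lift he)))
    have h6 := (pr_eq hs (pr_lift (pr_lift ha))).not
    have h7 := pr_TB (pr_lift (pr_lift hc)) (pr_lift (pr_lift ht)) hs (pr_lift hr)
    exact h5.and (h6.and h7)
  have h4 := pr_imp h1 (pr_iff h2 h3)
  refine pr_forall (pr_one he) ?_
  exact h4

theorem pr_modelCode {e n m c : α → ℕ} (he : Primrec e) (hn : Primrec n) (hm : Primrec m)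
    (hc : Primrec c) : PrimrecPred fun x => ModelCode (e x) (n x) (m x) (c x) := by
  have g1 : PrimrecPred fun x => ∃ a < m x, TB (c x) 0 a (e x + 1) ∧ TB (c x) 0 a (e x) := by
    refine pr_exists hm ?_
    have h1 := pr_TB (pr_lift hc) (Primrec.const 0) pr_last (pr_one (pr_lift he))
    have h2 := pr_TB (pr_lift hc) (Primrec.const 0) pr_last (pr_lift he)
    exact h1.and h2
  have ht : Primrec fun x : (α × ℕ) × ℕ => x.1.2 := pr_lift pr_last
  have ha : Primrec fun x : (α × ℕ) × ℕ => x.2 := pr_last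
  have he2 : Primrec fun x : (α × ℕ) × ℕ => e x.1.1 := pr_lift (pr_lift he)
  have hn2 : Primrec fun x : (α × ℕ) × ℕ => n x.1.1 := pr_lift (pr_lift hn)
  have hm2 : Primrec fun x : (α × ℕ) × ℕ => m x.1.1 := pr_lift (pr_lift hm)
  have hc2 : Primrec fun x : (α × ℕ) × ℕ => c x.1.1 := pr_lift (pr_lift hc)
  have k0 := pr_TB hc2 ht ha (pr_one he2)
  have k1 : PrimrecPred fun x : (α × ℕ) × ℕ =>
      ∀ s < n x.1.1, x.1.2 < s → TB (c x.1.1) s x.2 (e x.1.1 + 1) := by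
    refine pr_forall hn2 ?_
    have h1 := pr_lt (pr_lift ht) pr_last
    have h2 := pr_TB (pr_lift hc2) pr_last (pr_lift ha) (pr_one (pr_lift he2))
    exact pr_imp h1 h2
  have k2 := pr_clause_not he2 ht ha hc2
  have k3 := pr_clause_and he2 ht ha hc2
  have k4 := pr_clause_dia0 he2 hn2 ht ha hc2
  have k5 := pr_clause_dia1 he2 hm2 ht ha hc2
  have k := pr_imp k0 (k1.and (k2.and (k3.and (k4.and k5))))
  refine (pr_lt (Primrec.const 0) hn).and (g1.and ?_)
  refine pr_forall hn (pr_forall (pr_lift hm) ?_)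
  exact k

end Comp

/-- The length bound `N` is large enough for `e`. -/
def Enough (e N : ℕ) : Prop :=
  ¬ ∃ c < ((2 * e + 3) * N + 1) ^ (Nat.pair N (2 ^ (e + 1))), BadCode (2 ^ (e + 1)) (2 * e + 3) N c

/-- There is a small coded quasimodel of length below `N`. -/
def SmallModel (e N : ℕ) : Prop :=
  (∃ v < 2 ^ (e + 1), ValidCode e v) ∧
  ∃ n < N, ∃ c < 2 ^ (Nat.pair n (Nat.pair ((2 * e + 3) * n) (e + 2))),
    ModelCode e n ((2 * e + 3) * n) c

theorem pr_enough : PrimrecPred fun x : ℕ × ℕ => Enough x.1 x.2 := by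
  have he : Primrec fun x : ℕ × ℕ => x.1 := Primrec.fst
  have hN : Primrec fun x : ℕ × ℕ => x.2 := Primrec.snd
  have hC := pr_add (pr_mul (Primrec.const 2) he) (Primrec.const 3)
  have hd := pr_pow (Primrec.const 2) (pr_one he)
  exact (pr_exists (pr_pow (pr_one (pr_mul hC hN)) (pr_pair hN hd))
    (pr_badCode (pr_lift hd) (pr_lift hC) (pr_lift hN) pr_last)).not

theorem pr_smallModel : PrimrecPred fun x : ℕ × ℕ => SmallModel x.1 x.2 := by
  have he : Primrec fun x : ℕ × ℕ => x.1 := Primrec.fst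
  have hN : Primrec fun x : ℕ × ℕ => x.2 := Primrec.snd
  have hC := pr_add (pr_mul (Primrec.const 2) he) (Primrec.const 3)
  have hd := pr_pow (Primrec.const 2) (pr_one he)
  have hn : Primrec fun x : (ℕ × ℕ) × ℕ => x.2 := Primrec.snd
  have hm := pr_mul (pr_lift hC) hn
  exact (pr_exists hd (pr_validCode (pr_lift he) pr_last)).and
    (pr_exists hN (pr_exists
      (pr_pow (Primrec.const 2) (pr_pair hn (pr_pair hm (pr_add (pr_lift he) (Primrec.const 2)))))
      (pr_modelCode (pr_lift (pr_lift he)) (pr_lift hn) (pr_lift hm) pr_last)))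

theorem exists_enough (e : ℕ) : ∃ N, Enough e N := by
  obtain ⟨N, hN⟩ := exists_no_badSeq (2 ^ (e + 1)) (2 * e + 3)
  exact ⟨N, fun h => hN ((exists_badCode_iff _ _ _).1 h)⟩

theorem bcodes_iff {e N : ℕ} (hN : Enough e N) :
    BCodes (ExpDiffSat IsFinLinFrame) e ↔ SmallModel e N := by
  constructor
  · rintro ⟨φ, rfl, hφ⟩
    refine ⟨(validCode_iff _).2 ⟨φ, rfl⟩, ?_⟩
    obtain ⟨n, V, D, L, h⟩ := exists_QM_of_sat hφ
    obtain ⟨n, hn, V, _, D, L, hV, h⟩ :=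
      h.small (N := N) (fun hx => hN ((exists_badCode_iff _ _ _).2 hx))
    exact ⟨n, hn, modelCode_of_QM h hV⟩
  · rintro ⟨hv, n, _, c, _, hc⟩
    obtain ⟨φ, rfl⟩ := (validCode_iff _).1 hv
    exact ⟨φ, rfl, sat_of_QM (QM_of_modelCode hc)⟩

/-- Satisfiability over expanding 2-frames with horizontal frame a
finite linear order and all vertical frames difference frames is decidable. -/
theorem finlin_expanding_diff_decidable :
    ComputablePred (BCodes (ExpDiffSat IsFinLinFrame)) := by
  classical
  obtain ⟨_, hE⟩ := pr_enough
  obtain ⟨_, hS⟩ := pr_smallModel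
  have hfind : Computable fun e => Nat.find (exists_enough e) := by
    have h1 : Partrec fun e => Nat.rfind (fun N => (Part.some (decide (Enough e N)) : Part Bool)) :=
      Partrec.rfind (p := fun e N => Part.some (decide (Enough e N)))
        (Computable.partrec (hE.to_comp.of_eq fun x => by congr))
    refine h1.of_eq fun e => ?_
    refine Part.eq_some_iff.2 (Nat.mem_rfind.2 ⟨?_, ?_⟩)
    · simpa using Nat.find_spec (exists_enough e)
    · intro m hm
      simpa using Nat.find_min (exists_enough e) hm
  refine ⟨Classical.decPred _, ?_⟩
  refine (hS.to_comp.comp (Computable.pair Computable.id hfind)).of_eq fun e => ?_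
  have := bcodes_iff (Nat.find_spec (exists_enough e))
  simp only [id]
  rw [decide_eq_decide]
  exact this.symm

end HK
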